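/- arXiv:2504.00641 — 7 statements merged into one kernel-verified Lean document; each statement's English description precedes it below -/
import Mathlib

section
/- Under the standing assumptions, suppose p* ∈ ℝⁿ is an equilibrium price, i.e. p* is a subgradient of J at x*(p*). Then the demand profile x*(p*) is the unique global minimizer of the social cost C: for every x ∈ ℝⁿ with x ≠ x*(p*) one has C(x) > C(x*(p*)). -/
open scoped RealInnerProductSpace

/-- A function with strictly increasing derivative lies strictly above its tangent lines away from
the point of tangency. -/
theorem add_deriv_mul_sub_lt_of_strictMono_deriv {g : ℝ → ℝ} (hg : Differentiable ℝ g)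
    (hmono : StrictMono (deriv g)) {a b : ℝ} (hab : b ≠ a) :
    g a + deriv g a * (b - a) < g b := by
  rcases hab.lt_or_gt with h | h
  · obtain ⟨c, ⟨-, hca⟩, hc⟩ :=
      exists_deriv_eq_slope g h hg.continuous.continuousOn hg.differentiableOn
    rw [eq_div_iff (sub_pos.2 h).ne'] at hc
    nlinarith [mul_pos (sub_pos.2 (hmono hca)) (sub_pos.2 h)]
  · obtain ⟨c, ⟨hac, -⟩, hc⟩ :=
      exists_deriv_eq_slope g h hg.continuous.continuousOn hg.differentiableOn
    rw [eq_div_iff (sub_pos.2 h).ne'] at hc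
    nlinarith [mul_pos (sub_pos.2 (hmono hac)) (sub_pos.2 h)]

/-- Under the standing assumptions, if `p*` is an equilibrium price,
i.e. `p* ∈ ∂J(x*(p*))`, then the demand profile `x*(p*)` is the unique global
minimizer of the social cost `C`: `C x > C (x*(p*))` for every `x ≠ x*(p*)`. -/
theorem equilibrium_demand_is_unique_minimizer
    (n : ℕ) (f : Fin n → ℝ → ℝ)
    (hf : ∀ i, ContDiff ℝ 2 (f i))
    (hf'' : ∀ i, ∀ x : ℝ, 0 < deriv (deriv (f i)) x)
    (hsurj : ∀ i, Function.Surjective (deriv (f i)))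
    (J : EuclideanSpace ℝ (Fin n) → ℝ) (hJ : ConvexOn ℝ Set.univ J)
    (xs : EuclideanSpace ℝ (Fin n) → EuclideanSpace ℝ (Fin n))
    (hxs : ∀ p i, deriv (f i) (xs p i) + p i = 0)
    (C : EuclideanSpace ℝ (Fin n) → ℝ)
    (hC : ∀ x, C x = (∑ i, f i (x i)) + J x)
    (pstar : EuclideanSpace ℝ (Fin n))
    (heq : ∀ y, J y ≥ J (xs pstar) + ⟪pstar, y - xs pstar⟫) :
    ∀ x : EuclideanSpace ℝ (Fin n), x ≠ xs pstar → C x > C (xs pstar) := by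
  intro x hx
  have tangent : ∀ i, x i ≠ xs pstar i →
      f i (xs pstar i) - pstar i * (x i - xs pstar i) < f i (x i) := by
    intro i hi
    have h := add_deriv_mul_sub_lt_of_strictMono_deriv ((hf i).differentiable (by norm_num))
      (strictMono_of_deriv_pos (hf'' i)) hi
    rw [eq_neg_of_add_eq_zero_left (hxs pstar i)] at h
    linarith
  obtain ⟨j, hj⟩ : ∃ j, x j ≠ xs pstar j := by
    by_contra! h
    exact hx (PiLp.ext h)
  have hsum : ∑ i, (f i (xs pstar i) - pstar i * (x i - xs pstar i)) < ∑ i, f i (x i) := by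
    refine Finset.sum_lt_sum (fun i _ => ?_) ⟨j, Finset.mem_univ j, tangent j hj⟩
    by_cases hi : x i = xs pstar i
    · simp [hi]
    · exact (tangent i hi).le
  have hinner : ⟪pstar, x - xs pstar⟫ = ∑ i, pstar i * (x i - xs pstar i) := by
    simp [PiLp.inner_apply, mul_comm]
  have hJx := heq x
  rw [Finset.sum_sub_distrib] at hsum
  rw [hC, hC]
  linarith
end

section
/- Under the standing assumptions, the equilibrium price is unique: if p* ∈ ℝⁿ and p° ∈ ℝⁿ both satisfy the equilibrium condition (p* ∈ ∂J(x*(p*)) and p° ∈ ∂J(x*(p°))), then p* = p°. -/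
open scoped RealInnerProductSpace

/-- Subgradients of a function on an inner product space are monotone. -/
theorem inner_sub_sub_nonneg_of_subgradient {E : Type*} [NormedAddCommGroup E]
    [InnerProductSpace ℝ E] {J : E → ℝ} {x y p q : E}
    (hp : ∀ z, J z ≥ J x + ⟪p, z - x⟫) (hq : ∀ z, J z ≥ J y + ⟪q, z - y⟫) :
    0 ≤ ⟪p - q, x - y⟫ := by
  have h₁ := hp y
  have h₂ := hq x
  simp only [inner_sub_left, inner_sub_right] at *
  linarith

/-- If `-p` and `-q` are the values of a strictly increasing function at `x` and `y`, then
`p - q` and `x - y` have opposite signs, strictly so unless `p = q`. -/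
theorem StrictMono.sub_mul_sub_neg_of_add_eq_zero {g : ℝ → ℝ} (hg : StrictMono g)
    {x y p q : ℝ} (hp : g x + p = 0) (hq : g y + q = 0) (hne : p ≠ q) :
    (p - q) * (x - y) < 0 := by
  rcases lt_trichotomy x y with h | rfl | h
  · have := hg h
    exact mul_neg_of_pos_of_neg (by linarith) (by linarith)
  · exact absurd (by linarith) hne
  · have := hg h
    exact mul_neg_of_neg_of_pos (by linarith) (by linarith)

/-- Under the standing assumptions, the equilibrium price is unique:
if `p* ∈ ∂J(x*(p*))` and `p° ∈ ∂J(x*(p°))`, then `p* = p°`. -/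
theorem equilibrium_price_unique
    (n : ℕ) (f : Fin n → ℝ → ℝ)
    (hf : ∀ i, ContDiff ℝ 2 (f i))
    (hf'' : ∀ i, ∀ x : ℝ, 0 < deriv (deriv (f i)) x)
    (hsurj : ∀ i, Function.Surjective (deriv (f i)))
    (J : EuclideanSpace ℝ (Fin n) → ℝ) (hJ : ConvexOn ℝ Set.univ J)
    (xs : EuclideanSpace ℝ (Fin n) → EuclideanSpace ℝ (Fin n))
    (hxs : ∀ p i, deriv (f i) (xs p i) + p i = 0)
    (pstar pcirc : EuclideanSpace ℝ (Fin n))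
    (heqstar : ∀ y, J y ≥ J (xs pstar) + ⟪pstar, y - xs pstar⟫)
    (heqcirc : ∀ y, J y ≥ J (xs pcirc) + ⟪pcirc, y - xs pcirc⟫) :
    pstar = pcirc := by
  have hmono : ∀ i, StrictMono (deriv (f i)) := fun i => strictMono_of_deriv_pos (hf'' i)
  have hinner := inner_sub_sub_nonneg_of_subgradient heqstar heqcirc
  have hneg : ∀ i, pstar i ≠ pcirc i →
      (pstar i - pcirc i) * (xs pstar i - xs pcirc i) < 0 := fun i =>
    (hmono i).sub_mul_sub_neg_of_add_eq_zero (hxs pstar i) (hxs pcirc i)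
  by_contra hne
  obtain ⟨j, hj⟩ : ∃ j, pstar j ≠ pcirc j := by
    by_contra! h
    exact hne (PiLp.ext h)
  have hsum : ∑ i, (pstar i - pcirc i) * (xs pstar i - xs pcirc i) < ∑ _i : Fin n, (0 : ℝ) := by
    refine Finset.sum_lt_sum (fun i _ => ?_) ⟨j, Finset.mem_univ j, hneg j hj⟩
    by_cases h : pstar i = pcirc i
    · simp [h]
    · exact (hneg i h).le
  simp only [PiLp.inner_apply, PiLp.sub_apply, RCLike.inner_apply, conj_trivial, mul_comm, Finset.sum_const_zero]
    at hinner hsum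
  linarith
end

section
/- Under the standing assumptions, a price p ∈ ℝⁿ is an equilibrium (i.e. p ∈ ∂J(x*(p))) if and only if the demand profile x*(p) is a global minimizer of the social cost C over ℝⁿ. -/
open scoped RealInnerProductSpace

/-- A function on the line that is minimal over `[0, 1]` at `0` has nonnegative derivative there. -/
theorem HasDerivAt.nonneg_of_forall_Ioc_le {φ : ℝ → ℝ} {d : ℝ} (hφ : HasDerivAt φ d 0)
    (h : ∀ t, 0 < t → t ≤ 1 → φ 0 ≤ φ t) : 0 ≤ d := by
  refine ge_of_tendsto hφ.tendsto_slope_zero_right ?_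
  filter_upwards [Ioc_mem_nhdsGT (zero_lt_one' ℝ)] with t ht
  rw [zero_add, smul_eq_mul]
  exact mul_nonneg (inv_nonneg.2 ht.1.le) (sub_nonneg.2 (h t ht.1 ht.2))

theorem HasDerivAt.comp_add_mul_zero {g : ℝ → ℝ} {a d : ℝ} (hg : HasDerivAt g d a) (v : ℝ) :
    HasDerivAt (fun t => g (a + t * v)) (d * v) 0 := by
  have hline : HasDerivAt (fun t : ℝ => a + t * v) v 0 := by
    simpa using ((hasDerivAt_id (0 : ℝ)).mul_const v).const_add a
  have hg' : HasDerivAt g d (a + 0 * v) := by simpa using hg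
  exact hg'.comp (0 : ℝ) hline

/-- A convex function lies above its tangent lines. -/
theorem ConvexOn.add_mul_sub_le_of_hasDerivAt {g : ℝ → ℝ} {a d : ℝ}
    (hconv : ConvexOn ℝ Set.univ g) (hg : HasDerivAt g d a) (x : ℝ) :
    g a + d * (x - a) ≤ g x := by
  have hφ := ((hasDerivAt_id (0 : ℝ)).mul_const (g x - g a)).sub (hg.comp_add_mul_zero (x - a))
  have := hφ.nonneg_of_forall_Ioc_le fun t h0 h1 => by
    have h := hconv.2 (Set.mem_univ a) (Set.mem_univ x) (sub_nonneg.2 h1) h0.le (by ring)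
    have e : (1 - t) • a + t • x = a + t * (x - a) := by simp only [smul_eq_mul]; ring
    rw [e] at h
    simp only [smul_eq_mul] at h
    simp only [Pi.sub_apply, id_eq, zero_mul, add_zero]
    linarith
  linarith


/-- Under the standing assumptions, a price `p` is an equilibrium
(`p ∈ ∂J(x*(p))`) iff the demand profile `x*(p)` is a global minimizer of the
social cost `C` over ℝⁿ. -/
theorem equilibrium_iff_social_optimum
    (n : ℕ) (f : Fin n → ℝ → ℝ)
    (hf : ∀ i, ContDiff ℝ 2 (f i))
    (hf'' : ∀ i, ∀ x : ℝ, 0 < deriv (deriv (f i)) x)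
    (hsurj : ∀ i, Function.Surjective (deriv (f i)))
    (J : EuclideanSpace ℝ (Fin n) → ℝ) (hJ : ConvexOn ℝ Set.univ J)
    (xs : EuclideanSpace ℝ (Fin n) → EuclideanSpace ℝ (Fin n))
    (hxs : ∀ p i, deriv (f i) (xs p i) + p i = 0)
    (C : EuclideanSpace ℝ (Fin n) → ℝ)
    (hC : ∀ x, C x = (∑ i, f i (x i)) + J x)
    (p : EuclideanSpace ℝ (Fin n)) :
    (∀ y, J y ≥ J (xs p) + ⟪p, y - xs p⟫) ↔ (∀ x, C (xs p) ≤ C x) := by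
  have hderiv : ∀ i, HasDerivAt (f i) (-p i) (xs p i) := fun i => by
    rw [← eq_neg_of_add_eq_zero_left (hxs p i)]
    exact ((hf i).differentiable (by norm_num) _).hasDerivAt
  have hinner : ∀ v : EuclideanSpace ℝ (Fin n), ⟪p, v⟫ = ∑ i, p i * v i := fun v => by
    simp [PiLp.inner_apply, mul_comm]
  constructor
  · intro hp x
    have hconv : ∀ i, ConvexOn ℝ Set.univ (f i) := fun i =>
      (strictConvexOn_univ_of_deriv2_pos (hf i).continuous (hf'' i)).convexOn
    have hsum := Finset.sum_le_sum fun i (_ : i ∈ Finset.univ) =>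
      (hconv i).add_mul_sub_le_of_hasDerivAt (hderiv i) (x i)
    have hx := hp x
    rw [hinner] at hx
    simp only [Finset.sum_add_distrib, neg_mul, Finset.sum_neg_distrib] at hsum
    simp only [PiLp.sub_apply] at hx
    rw [hC, hC]
    linarith
  · intro hmin y
    have hφ := (HasDerivAt.fun_sum fun i (_ : i ∈ Finset.univ) =>
      (hderiv i).comp_add_mul_zero ((y - xs p) i)).add
        ((hasDerivAt_id (0 : ℝ)).mul_const (J y - J (xs p)))
    have hd := hφ.nonneg_of_forall_Ioc_le fun t h0 h1 => by
      have h := hJ.2 (Set.mem_univ (xs p)) (Set.mem_univ y) (sub_nonneg.2 h1) h0.le (by ring)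
      have e : (1 - t) • xs p + t • y = xs p + t • (y - xs p) := by module
      have hm := hmin (xs p + t • (y - xs p))
      rw [e] at h
      rw [hC, hC] at hm
      simp only [smul_eq_mul] at h
      simp only [PiLp.add_apply, PiLp.smul_apply, smul_eq_mul] at hm
      simp only [Pi.add_apply, id_eq, zero_mul, add_zero]
      linarith
    rw [hinner]
    simp only [neg_mul, Finset.sum_neg_distrib] at hd
    linarith
end

section
/- Under the standing assumptions, let p* ∈ ℝⁿ be an equilibrium price (p* ∈ ∂J(x*(p*))) and define V(p) = C(x*(p)) − C(x*(p*)). Then V(p*) = 0 and V(p) > 0 for every p ∈ ℝⁿ with p ≠ p*. -/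
open scoped RealInnerProductSpace

/-- The graph of a strictly convex function lies strictly above each of its tangent lines,
away from the point of tangency. -/
theorem StrictConvexOn.add_deriv_mul_sub_lt {g : ℝ → ℝ} (hg : StrictConvexOn ℝ Set.univ g)
    {a b : ℝ} (hd : DifferentiableAt ℝ g a) (hab : b ≠ a) :
    g a + deriv g a * (b - a) < g b := by
  rcases lt_or_gt_of_ne hab with h | h
  · have hs := hg.slope_lt_of_hasDerivAt (Set.mem_univ b) (Set.mem_univ a) h hd.hasDerivAt
    rw [slope_def_field, div_lt_iff₀ (sub_pos.2 h)] at hs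
    linarith
  · have hs := hg.lt_slope_of_hasDerivAt (Set.mem_univ a) (Set.mem_univ b) h hd.hasDerivAt
    rw [slope_def_field, lt_div_iff₀ (sub_pos.2 h)] at hs
    linarith

/-- Under the standing assumptions, with `p*` an equilibrium price
(`p* ∈ ∂J(x*(p*))`) and `V(p) = C(x*(p)) - C(x*(p*))`, the Lyapunov candidate
satisfies `V(p*) = 0` and `V(p) > 0` for every `p ≠ p*`. -/
theorem lyapunov_candidate_positive_definite
    (n : ℕ) (f : Fin n → ℝ → ℝ)
    (hf : ∀ i, ContDiff ℝ 2 (f i))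
    (hf'' : ∀ i, ∀ x : ℝ, 0 < deriv (deriv (f i)) x)
    (hsurj : ∀ i, Function.Surjective (deriv (f i)))
    (J : EuclideanSpace ℝ (Fin n) → ℝ) (hJ : ConvexOn ℝ Set.univ J)
    (xs : EuclideanSpace ℝ (Fin n) → EuclideanSpace ℝ (Fin n))
    (hxs : ∀ p i, deriv (f i) (xs p i) + p i = 0)
    (C : EuclideanSpace ℝ (Fin n) → ℝ)
    (hC : ∀ x, C x = (∑ i, f i (x i)) + J x)
    (pstar : EuclideanSpace ℝ (Fin n))
    (heq : ∀ y, J y ≥ J (xs pstar) + ⟪pstar, y - xs pstar⟫)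
    (V : EuclideanSpace ℝ (Fin n) → ℝ)
    (hV : ∀ p, V p = C (xs p) - C (xs pstar)) :
    V pstar = 0 ∧ ∀ p : EuclideanSpace ℝ (Fin n), p ≠ pstar → V p > 0 := by
  refine ⟨by rw [hV, sub_self], fun p hp => ?_⟩
  have tangent : ∀ i (b : ℝ), b ≠ xs pstar i →
      f i (xs pstar i) - pstar i * (b - xs pstar i) < f i b := by
    intro i b hb
    have hconv : StrictConvexOn ℝ Set.univ (f i) :=
      strictConvexOn_univ_of_deriv2_pos (hf i).continuous (hf'' i)
    have h := hconv.add_deriv_mul_sub_lt ((hf i).differentiable (by norm_num) _) hb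
    rwa [eq_neg_of_add_eq_zero_left (hxs pstar i), neg_mul, ← sub_eq_add_neg] at h
  obtain ⟨j, hj⟩ : ∃ j, xs p j ≠ xs pstar j := by
    by_contra! h
    refine hp (PiLp.ext fun i => ?_)
    have h₁ := hxs p i
    rw [h i] at h₁
    linarith [hxs pstar i]
  have hsum : ∑ i, (f i (xs pstar i) - pstar i * (xs p i - xs pstar i)) <
      ∑ i, f i (xs p i) := by
    refine Finset.sum_lt_sum (fun i _ => ?_) ⟨j, Finset.mem_univ j, tangent j _ hj⟩
    by_cases hi : xs p i = xs pstar i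
    · simp [hi]
    · exact (tangent i _ hi).le
  have hinner : ⟪pstar, xs p - xs pstar⟫ = ∑ i, pstar i * (xs p i - xs pstar i) := by
    simp [PiLp.inner_apply, mul_comm]
  rw [Finset.sum_sub_distrib, ← hinner] at hsum
  rw [hV, hC, hC]
  linarith [heq (xs p)]
end

section
/- Under the standing assumptions, let p* ∈ ℝⁿ be the equilibrium price (p* ∈ ∂J(x*(p*))). Then for every p ∈ ℝⁿ with p ≠ p* and every subgradient η ∈ ∂J(x*(p)), the vector v = η − p is nonzero and Σ_{i=1}^n (x*_i)'(p_i) · v_i² < 0, where (x*_i)'(p_i) = −1 / f_i''(x*_i(p_i)) < 0 is the derivative of the demand function. -/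
open scoped RealInnerProductSpace

/-- The subgradients of a function are monotone. -/
lemma inner_sub_nonneg_of_subgradients {E : Type*} [NormedAddCommGroup E]
    [InnerProductSpace ℝ E] {J : E → ℝ} {x y g h : E}
    (hg : ∀ z, J z ≥ J x + ⟪g, z - x⟫) (hh : ∀ z, J z ≥ J y + ⟪h, z - y⟫) :
    0 ≤ ⟪g - h, x - y⟫ := by
  have h₁ := hg y
  have h₂ := hh x
  rw [← neg_sub x y, inner_neg_right] at h₁
  rw [inner_sub_left]
  linarith

lemma StrictMono.sub_mul_sub_pos {φ : ℝ → ℝ} (hφ : StrictMono φ) {a b : ℝ} (hab : a ≠ b) :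
    0 < (φ a - φ b) * (a - b) := by
  rcases hab.lt_or_gt with h | h
  · exact mul_pos_of_neg_of_neg (sub_neg.2 (hφ h)) (sub_neg.2 h)
  · exact mul_pos (sub_pos.2 (hφ h)) (sub_pos.2 h)

/-- A coordinatewise strictly decreasing demand reverses the direction of price changes. -/
lemma inner_sub_demand_neg {ι : Type*} [Fintype ι] {φ : ι → ℝ → ℝ}
    (hφ : ∀ i, StrictMono (φ i)) {xs : EuclideanSpace ℝ ι → EuclideanSpace ℝ ι}
    (hxs : ∀ p i, φ i (xs p i) + p i = 0) {p q : EuclideanSpace ℝ ι} (hpq : p ≠ q) :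
    ⟪p - q, xs p - xs q⟫ < 0 := by
  have hprice : ∀ r i, r i = -φ i (xs r i) := fun r i => by linarith [hxs r i]
  have hterm : ∀ i, p i ≠ q i → (p i - q i) * (xs p i - xs q i) < 0 := fun i hi => by
    have hne : xs p i ≠ xs q i := fun h => hi (by rw [hprice p, hprice q, h])
    have := (hφ i).sub_mul_sub_pos hne
    rw [hprice p, hprice q]
    linarith
  obtain ⟨j, hj⟩ : ∃ j, p j ≠ q j := by
    by_contra! h
    exact hpq (PiLp.ext h)
  have hsum : ⟪p - q, xs p - xs q⟫ = ∑ i, (p i - q i) * (xs p i - xs q i) := by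
    simp [PiLp.inner_apply, mul_comm]
  rw [hsum]
  refine Finset.sum_neg' (fun i _ => ?_) ⟨j, Finset.mem_univ j, hterm j hj⟩
  by_cases hi : p i = q i
  · simp [hi]
  · exact (hterm i hi).le

lemma sum_neg_one_div_mul_sq_neg {ι : Type*} [Fintype ι] {c : ι → ℝ} (hc : ∀ i, 0 < c i)
    {v : EuclideanSpace ℝ ι} (hv : v ≠ 0) : ∑ i, (-(1 / c i)) * v i ^ 2 < 0 := by
  obtain ⟨j, hj⟩ : ∃ j, v j ≠ 0 := by
    by_contra! h
    exact hv (PiLp.ext h)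
  have hneg : ∀ i, -(1 / c i) < 0 := fun i => neg_neg_of_pos (one_div_pos.2 (hc i))
  exact Finset.sum_neg' (fun i _ => mul_nonpos_of_nonpos_of_nonneg (hneg i).le (sq_nonneg _))
    ⟨j, Finset.mem_univ j, mul_neg_of_neg_of_pos (hneg j) (by positivity)⟩

/-- Under the standing assumptions, with `p*` the equilibrium price,
for every `p ≠ p*` and every subgradient `η ∈ ∂J(x*(p))`, the vector `v = η - p`
is nonzero and `Σ_i (x*_i)'(p_i) · v_i² < 0`, where
`(x*_i)'(p_i) = -1 / f_i''(x*_i(p_i)) < 0`. -/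
theorem lie_derivative_value_negative
    (n : ℕ) (f : Fin n → ℝ → ℝ)
    (hf : ∀ i, ContDiff ℝ 2 (f i))
    (hf'' : ∀ i, ∀ x : ℝ, 0 < deriv (deriv (f i)) x)
    (hsurj : ∀ i, Function.Surjective (deriv (f i)))
    (J : EuclideanSpace ℝ (Fin n) → ℝ) (hJ : ConvexOn ℝ Set.univ J)
    (xs : EuclideanSpace ℝ (Fin n) → EuclideanSpace ℝ (Fin n))
    (hxs : ∀ p i, deriv (f i) (xs p i) + p i = 0)
    (pstar : EuclideanSpace ℝ (Fin n))
    (heq : ∀ y, J y ≥ J (xs pstar) + ⟪pstar, y - xs pstar⟫)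
    (p : EuclideanSpace ℝ (Fin n)) (hp : p ≠ pstar)
    (η : EuclideanSpace ℝ (Fin n))
    (hη : ∀ y, J y ≥ J (xs p) + ⟪η, y - xs p⟫) :
    η - p ≠ 0 ∧
    (∑ i, (-(1 / deriv (deriv (f i)) (xs p i))) * ((η - p) i) ^ 2) < 0 := by
  have hv : η - p ≠ 0 := fun h => by
    obtain rfl := sub_eq_zero.1 h
    exact (inner_sub_demand_neg (fun i => strictMono_of_deriv_pos (hf'' i)) hxs hp).not_ge
      (inner_sub_nonneg_of_subgradients hη heq)
  exact ⟨hv, sum_neg_one_div_mul_sq_neg (fun i => hf'' i _) hv⟩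
end

section
/- Under the standing assumptions, let p ∈ ℝⁿ and suppose J is differentiable at x*(p) with gradient ∇J(x*(p)). Then the function W(q) = C(x*(q)) is differentiable at p, and its partial derivatives are ∂W/∂p_i (p) = (x*_i)'(p_i) · ((∇J(x*(p)))_i − p_i) for each i, where (x*_i)'(p_i) = −1 / f_i''(x*_i(p_i)). -/
/-- A right inverse of a real function with everywhere positive derivative is differentiable, with
the reciprocal derivative. -/
theorem hasDerivAt_rightInverse_of_deriv_pos {φ ψ : ℝ → ℝ} (hφ : ∀ x, 0 < deriv φ x)
    (hψ : Function.RightInverse ψ φ) (y : ℝ) : HasDerivAt ψ (deriv φ (ψ y))⁻¹ y := by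
  let e := (strictMono_of_deriv_pos hφ).orderIsoOfSurjective φ hψ.surjective
  have hcont : Continuous ψ := by
    have he : ψ = e.symm := funext fun z => e.injective <| by
      rw [e.apply_symm_apply]
      exact hψ z
    rw [he]
    exact e.symm.continuous
  exact (differentiableAt_of_deriv_ne_zero (hφ _).ne').hasDerivAt.of_local_left_inverse
    hcont.continuousAt (hφ _).ne' (.of_forall hψ)


/-- Under the standing assumptions, if `J` is differentiable at
`x*(p)`, then `W(q) = C(x*(q))` is differentiable at `p` with partial derivatives
`∂W/∂p_i (p) = (x*_i)'(p_i) · ((∇J(x*(p)))_i - p_i)`, where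
`(x*_i)'(p_i) = -1 / f_i''(x*_i(p_i))`. -/
theorem composed_cost_partial_derivatives
    (n : ℕ) (f : Fin n → ℝ → ℝ)
    (hf : ∀ i, ContDiff ℝ 2 (f i))
    (hf'' : ∀ i, ∀ x : ℝ, 0 < deriv (deriv (f i)) x)
    (hsurj : ∀ i, Function.Surjective (deriv (f i)))
    (J : EuclideanSpace ℝ (Fin n) → ℝ) (hJ : ConvexOn ℝ Set.univ J)
    (xs : EuclideanSpace ℝ (Fin n) → EuclideanSpace ℝ (Fin n))
    (hxs : ∀ p i, deriv (f i) (xs p i) + p i = 0)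
    (C : EuclideanSpace ℝ (Fin n) → ℝ)
    (hC : ∀ x, C x = (∑ i, f i (x i)) + J x)
    (p : EuclideanSpace ℝ (Fin n))
    (hJd : DifferentiableAt ℝ J (xs p)) :
    DifferentiableAt ℝ (fun q => C (xs q)) p ∧
    ∀ i, fderiv ℝ (fun q => C (xs q)) p (EuclideanSpace.single i 1) =
      (-(1 / deriv (deriv (f i)) (xs p i))) * (gradient J (xs p) i - p i) := by
  have hxsi : ∀ i, HasFDerivAt (fun q => xs q i)
      ((-(1 / deriv (deriv (f i)) (xs p i))) •
        (EuclideanSpace.proj i : EuclideanSpace ℝ (Fin n) →L[ℝ] ℝ)) p := by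
    intro i
    have hψ : Function.RightInverse (Function.surjInv (hsurj i)) (deriv (f i)) :=
      Function.rightInverse_surjInv (hsurj i)
    have hq : ∀ q, xs q i = Function.surjInv (hsurj i) (-(q i)) := fun q =>
      (strictMono_of_deriv_pos (hf'' i)).injective <| by
        rw [hψ]
        linarith [hxs q i]
    have hd := (hasDerivAt_rightInverse_of_deriv_pos (hf'' i) hψ (-(p i))).comp_hasFDerivAt p
      (EuclideanSpace.proj i : EuclideanSpace ℝ (Fin n) →L[ℝ] ℝ).hasFDerivAt.neg
    rw [← hq] at hd
    simp only [hq]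
    rw [← hq]
    refine hd.congr_fderiv ?_
    ext v
    simp
  have hxsd : DifferentiableAt ℝ xs p :=
    differentiableAt_euclidean.2 fun i => (hxsi i).differentiableAt
  have hproj : ∀ i, HasFDerivAt (fun q => xs q i)
      ((EuclideanSpace.proj i : EuclideanSpace ℝ (Fin n) →L[ℝ] ℝ).comp (fderiv ℝ xs p)) p :=
    fun i => (EuclideanSpace.proj i : EuclideanSpace ℝ (Fin n) →L[ℝ] ℝ).hasFDerivAt.comp p
      hxsd.hasFDerivAt
  have hsingle : ∀ i, fderiv ℝ xs p (EuclideanSpace.single i 1) =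
      (-(1 / deriv (deriv (f i)) (xs p i))) • EuclideanSpace.single i 1 := by
    intro i
    ext j
    have h := DFunLike.congr_fun ((hproj j).unique (hxsi j)) (EuclideanSpace.single i (1 : ℝ))
    rcases eq_or_ne j i with rfl | hji
    · simpa using h
    · simpa [hji] using h
  have hfi : ∀ i, HasFDerivAt (fun q => f i (xs q i))
      ((-p i) • (EuclideanSpace.proj i : EuclideanSpace ℝ (Fin n) →L[ℝ] ℝ).comp
        (fderiv ℝ xs p)) p := by
    intro i
    have h := HasDerivAt.comp_hasFDerivAt (f := fun q => xs q i) p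
      ((hf i).differentiable two_ne_zero (xs p i)).hasDerivAt (hproj i)
    rwa [eq_neg_of_add_eq_zero_left (hxs p i)] at h
  have hW := (HasFDerivAt.fun_sum fun i (_ : i ∈ Finset.univ) => hfi i).add
    (hJd.hasGradientAt.hasFDerivAt.comp p hxsd.hasFDerivAt)
  have hCW : (fun q => C (xs q)) = (fun q => ∑ i, f i (xs q i)) + J ∘ xs :=
    funext fun q => hC (xs q)
  rw [← hCW] at hW
  refine ⟨hW.differentiableAt, fun i => ?_⟩
  have hgrad : fderiv ℝ J (xs p) (EuclideanSpace.single i 1) = gradient J (xs p) i := by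
    rw [hJd.hasGradientAt.hasFDerivAt.fderiv, InnerProductSpace.toDual_apply_apply,
      EuclideanSpace.inner_single_right]
    simp
  rw [hW.fderiv]
  simp [hsingle, hgrad]
  ring
end

section
/- Under the standing assumptions, let p* ∈ ℝⁿ be the equilibrium price (p* ∈ ∂J(x*(p*))) and V(p) = C(x*(p)) − C(x*(p*)). Let I ⊆ ℝ be an open interval and p : I → ℝⁿ a differentiable trajectory such that, for every t ∈ I, J is differentiable at x*(p(t)) and ṗ_i(t) = (∇J(x*(p(t))))_i − p_i(t) for all i. Then t ↦ V(p(t)) is differentiable on I with derivative Σ_{i=1}^n (x*_i)'(p_i(t)) · v_i(t)², where v_i(t) = (∇J(x*(p(t))))_i − p_i(t) and (x*_i)'(p_i(t)) = −1/f_i''(x*_i(p_i(t))); in particular, d/dt V(p(t)) < 0 whenever p(t) ≠ p*. -/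
open scoped RealInnerProductSpace

/-- If `φ` is strictly increasing and onto and `φ ∘ x` is differentiable, then so is `x`. -/
theorem hasDerivAt_of_comp_strictMono {φ x : ℝ → ℝ} {φ' c t : ℝ} (hmono : StrictMono φ)
    (hsurj : Function.Surjective φ) (hφ : HasDerivAt φ φ' (x t)) (hφ' : φ' ≠ 0)
    (hc : HasDerivAt (fun s => φ (x s)) c t) : HasDerivAt x (c / φ') t := by
  let e := hmono.orderIsoOfSurjective φ hsurj
  have hx : x = fun s => e.symm (φ (x s)) := by
    ext s
    exact (e.symm_apply_apply (x s)).symm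
  have hcont : ContinuousAt x t := by
    rw [hx]
    exact e.symm.continuous.continuousAt.comp hc.continuousAt
  have h := HasDerivAt.of_comp_left hcont hφ hc hφ' (Filter.Eventually.of_forall fun _ => rfl)
  simpa [div_eq_mul_inv, mul_comm] using h

/-- The gradient of a convex function is a subgradient wherever it exists. -/
theorem ConvexOn.add_inner_gradient_le {E : Type*} [NormedAddCommGroup E]
    [InnerProductSpace ℝ E] [CompleteSpace E] {J : E → ℝ} (hJ : ConvexOn ℝ Set.univ J) {x : E}
    (hd : DifferentiableAt ℝ J x) (y : E) : J x + ⟪gradient J x, y - x⟫ ≤ J y := by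
  have hline : ConvexOn ℝ Set.univ (J ∘ AffineMap.lineMap (k := ℝ) x y) :=
    hJ.comp_affineMap (AffineMap.lineMap x y)
  have hderiv : HasDerivAt (J ∘ AffineMap.lineMap (k := ℝ) x y) ⟪gradient J x, y - x⟫ 0 := by
    have h := hd.hasGradientAt.hasFDerivAt
    rw [← AffineMap.lineMap_apply_zero (k := ℝ) x y] at h
    simpa using h.comp_hasDerivAt (0 : ℝ) AffineMap.hasDerivAt_lineMap
  have h := hline.le_slope_of_hasDerivAt (Set.mem_univ 0) (Set.mem_univ 1) one_pos hderiv
  simp only [slope_def_field, Function.comp_apply, AffineMap.lineMap_apply_one,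
    AffineMap.lineMap_apply_zero, sub_zero, div_one] at h
  linarith

theorem hasDerivAt_euclidean {ι : Type*} [Fintype ι] {x : ℝ → EuclideanSpace ℝ ι}
    {x' : EuclideanSpace ℝ ι} {t : ℝ} :
    HasDerivAt x x' t ↔ ∀ i, HasDerivAt (fun s => x s i) (x' i) t := by
  refine ⟨fun h i => ?_, fun h => ?_⟩
  · exact (EuclideanSpace.proj (𝕜 := ℝ) i).hasFDerivAt.comp_hasDerivAt t h
  · exact (EuclideanSpace.equiv ι ℝ).symm.hasFDerivAt.comp_hasDerivAt t (hasDerivAt_pi.2 h)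

/-- Under the standing assumptions, along any differentiable
trajectory `p(t)` of the price dynamics `ṗ = ∇J(x*(p)) - p` (on an open interval
where `J` is differentiable at `x*(p(t))`), the Lyapunov candidate
`V(p) = C(x*(p)) - C(x*(p*))` satisfies
`d/dt V(p(t)) = Σ_i (x*_i)'(p_i(t)) v_i(t)²` with
`v_i(t) = (∇J(x*(p(t))))_i - p_i(t)` and `(x*_i)'(p_i(t)) = -1/f_i''(x*_i(p_i(t)))`;
in particular the derivative is negative whenever `p(t) ≠ p*`. -/
theorem lyapunov_decreases_along_trajectories
    (n : ℕ) (f : Fin n → ℝ → ℝ)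
    (hf : ∀ i, ContDiff ℝ 2 (f i))
    (hf'' : ∀ i, ∀ x : ℝ, 0 < deriv (deriv (f i)) x)
    (hsurj : ∀ i, Function.Surjective (deriv (f i)))
    (J : EuclideanSpace ℝ (Fin n) → ℝ) (hJ : ConvexOn ℝ Set.univ J)
    (xs : EuclideanSpace ℝ (Fin n) → EuclideanSpace ℝ (Fin n))
    (hxs : ∀ p i, deriv (f i) (xs p i) + p i = 0)
    (C : EuclideanSpace ℝ (Fin n) → ℝ)
    (hC : ∀ x, C x = (∑ i, f i (x i)) + J x)
    (pstar : EuclideanSpace ℝ (Fin n))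
    (heq : ∀ y, J y ≥ J (xs pstar) + ⟪pstar, y - xs pstar⟫)
    (V : EuclideanSpace ℝ (Fin n) → ℝ)
    (hV : ∀ p, V p = C (xs p) - C (xs pstar))
    (I : Set ℝ) (hIopen : IsOpen I) (hIinterval : I.OrdConnected)
    (ptraj p' : ℝ → EuclideanSpace ℝ (Fin n))
    (hptraj : ∀ t ∈ I, HasDerivAt ptraj (p' t) t)
    (hJd : ∀ t ∈ I, DifferentiableAt ℝ J (xs (ptraj t)))
    (hdyn : ∀ t ∈ I, ∀ i, p' t i = gradient J (xs (ptraj t)) i - ptraj t i) :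
    ∀ t ∈ I,
      HasDerivAt (fun s => V (ptraj s))
        (∑ i, (-(1 / deriv (deriv (f i)) (xs (ptraj t) i))) *
          (gradient J (xs (ptraj t)) i - ptraj t i) ^ 2) t ∧
      (ptraj t ≠ pstar →
        (∑ i, (-(1 / deriv (deriv (f i)) (xs (ptraj t) i))) *
          (gradient J (xs (ptraj t)) i - ptraj t i) ^ 2) < 0) := by
  have hmono : ∀ i, StrictMono (deriv (f i)) := fun i => strictMono_of_deriv_pos (hf'' i)
  have hdiff : ∀ i, Differentiable ℝ (deriv (f i)) := fun i =>
    ((contDiff_succ_iff_deriv (n := 1)).1 (hf i)).2.2.differentiable one_ne_zero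
  intro t ht
  constructor
  · have hx : ∀ i, HasDerivAt (fun s => xs (ptraj s) i)
        (-(p' t i) / deriv (deriv (f i)) (xs (ptraj t) i)) t := by
      intro i
      refine hasDerivAt_of_comp_strictMono (hmono i) (hsurj i) (hdiff i _).hasDerivAt
        (hf'' i _).ne' ?_
      have h : (fun s => deriv (f i) (xs (ptraj s) i)) = fun s => -(ptraj s i) :=
        funext fun s => eq_neg_of_add_eq_zero_left (hxs (ptraj s) i)
      rw [h]
      exact ((hasDerivAt_euclidean.1 (hptraj t ht)) i).neg
    have hX : HasDerivAt (fun s => xs (ptraj s))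
        (WithLp.toLp 2 fun i => -(p' t i) / deriv (deriv (f i)) (xs (ptraj t) i)) t :=
      hasDerivAt_euclidean.2 hx
    have hF : HasDerivAt (fun s => ∑ i, f i (xs (ptraj s) i))
        (∑ i, -(ptraj t i) * (-(p' t i) / deriv (deriv (f i)) (xs (ptraj t) i))) t := by
      refine HasDerivAt.fun_sum fun i _ => ?_
      rw [← eq_neg_of_add_eq_zero_left (hxs (ptraj t) i)]
      exact ((hf i).differentiable two_ne_zero _).hasDerivAt.comp t (hx i)
    have hJX := (hJd t ht).hasGradientAt.hasFDerivAt.comp_hasDerivAt t hX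
    have hV' : (fun s => V (ptraj s)) = fun s =>
        (∑ i, f i (xs (ptraj s) i)) + (J ∘ fun s => xs (ptraj s)) s - C (xs pstar) := by
      ext s
      simp [hV, hC]
    rw [hV']
    refine ((hF.add hJX).sub_const (C (xs pstar))).congr_deriv ?_
    rw [InnerProductSpace.toDual_apply_apply]
    simp only [PiLp.inner_apply, ← Finset.sum_add_distrib]
    refine Finset.sum_congr rfl fun i _ => ?_
    simp only [hdyn t ht i, RCLike.inner_apply, conj_trivial]
    ring
  · intro hne
    by_contra! hnonneg
    have hle : ∀ i ∈ Finset.univ, (-(1 / deriv (deriv (f i)) (xs (ptraj t) i))) *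
        (gradient J (xs (ptraj t)) i - ptraj t i) ^ 2 ≤ 0 := fun i _ =>
      mul_nonpos_of_nonpos_of_nonneg (neg_nonpos.2 (one_div_pos.2 (hf'' i _)).le) (sq_nonneg _)
    have hzero := (Finset.sum_eq_zero_iff_of_nonpos hle).1
      (le_antisymm (Finset.sum_nonpos hle) hnonneg)
    have hgrad : gradient J (xs (ptraj t)) = ptraj t := by
      ext i
      have h := hzero i (Finset.mem_univ i)
      simpa [(hf'' i _).ne', sub_eq_zero] using h
    have hsub := hJ.add_inner_gradient_le (hJd t ht) (xs pstar)
    rw [hgrad] at hsub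
    have hstar := heq (xs (ptraj t))
    have hinner : 0 ≤ ⟪ptraj t - pstar, xs (ptraj t) - xs pstar⟫ := by
      rw [← neg_sub (xs (ptraj t)), inner_neg_right] at hsub
      rw [inner_sub_left]
      linarith
    obtain ⟨j, hj⟩ : ∃ j, ptraj t j ≠ pstar j := by
      by_contra! h
      exact hne (PiLp.ext h)
    have hprice : ∀ i, ptraj t i - pstar i =
        -(deriv (f i) (xs (ptraj t) i) - deriv (f i) (xs pstar i)) := fun i => by
      linarith [hxs (ptraj t) i, hxs pstar i]
    have hterm : ∀ i, (xs (ptraj t) i - xs pstar i) * (ptraj t i - pstar i) ≤ 0 ∧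
        (ptraj t i ≠ pstar i → (xs (ptraj t) i - xs pstar i) * (ptraj t i - pstar i) < 0) := by
      intro i
      rw [← sub_ne_zero, hprice i]
      rcases lt_trichotomy (xs (ptraj t) i) (xs pstar i) with h | h | h
      · have := mul_pos_of_neg_of_neg (sub_neg.2 h) (sub_neg.2 (hmono i h))
        constructor <;> intros <;> linarith
      · simp [h]
      · have := mul_pos (sub_pos.2 h) (sub_pos.2 (hmono i h))
        constructor <;> intros <;> linarith
    have hneg : ∑ i, (xs (ptraj t) i - xs pstar i) * (ptraj t i - pstar i) < 0 :=
      Finset.sum_neg' (fun i _ => (hterm i).1) ⟨j, Finset.mem_univ j, (hterm j).2 hj⟩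
    simp only [PiLp.inner_apply, RCLike.inner_apply, conj_trivial, PiLp.sub_apply] at hinner
    linarith
end
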